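/- Maximum plastic dissipation for the Drucker–Prager smooth return: in the smooth-return case (Ψ(σ^tr) > 0 and η p^tr − (Kη²/(G√2)) ρ^tr < c), the plastic strain increment satisfies the variational inequality (ε^p_k − ε^p_{k−1}) : (τ − σ_k) ≤ 0 for every τ ∈ Sym(3) with Ψ(τ) ≤ 0. -/

import Mathlib

open Matrix

/-- Frobenius inner product on 3×3 real matrices. -/
noncomputable def frob (σ τ : Matrix (Fin 3) (Fin 3) ℝ) : ℝ := ∑ i, ∑ j, σ i j * τ i j

/-- Frobenius norm. -/
noncomputable def fnorm (τ : Matrix (Fin 3) (Fin 3) ℝ) : ℝ := Real.sqrt (frob τ τ)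

/-- Deviatoric part. -/
noncomputable def devM (τ : Matrix (Fin 3) (Fin 3) ℝ) : Matrix (Fin 3) (Fin 3) ℝ :=
  τ - (Matrix.trace τ / 3) • (1 : Matrix (Fin 3) (Fin 3) ℝ)

/-- The isotropic elasticity tensor `ℂε = K tr(ε) I + 2G dev(ε)`. -/
noncomputable def Celast (K G : ℝ) (ε : Matrix (Fin 3) (Fin 3) ℝ) : Matrix (Fin 3) (Fin 3) ℝ :=
  (K * Matrix.trace ε) • (1 : Matrix (Fin 3) (Fin 3) ℝ) + (2 * G) • devM ε

/-- The Drucker–Prager yield function `Ψ(τ) = √(1/2)|dev τ| + (η/3) tr τ − c`. -/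
noncomputable def PsiDP (η c : ℝ) (τ : Matrix (Fin 3) (Fin 3) ℝ) : ℝ :=
  Real.sqrt (1 / 2) * fnorm (devM τ) + η / 3 * Matrix.trace τ - c

lemma frob_add_left (A B C : Matrix (Fin 3) (Fin 3) ℝ) :
    frob (A + B) C = frob A C + frob B C := by
  simp [frob, add_mul, Finset.sum_add_distrib]

lemma frob_sub_right (A B C : Matrix (Fin 3) (Fin 3) ℝ) :
    frob A (B - C) = frob A B - frob A C := by
  simp [frob, mul_sub, Finset.sum_sub_distrib]

lemma frob_smul_left (a : ℝ) (A B : Matrix (Fin 3) (Fin 3) ℝ) :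
    frob (a • A) B = a * frob A B := by
  simp [frob, mul_assoc, Finset.mul_sum]

lemma frob_smul_right (a : ℝ) (A B : Matrix (Fin 3) (Fin 3) ℝ) :
    frob A (a • B) = a * frob A B := by
  simp [frob, mul_left_comm, Finset.mul_sum]

lemma frob_one_left (A : Matrix (Fin 3) (Fin 3) ℝ) : frob 1 A = Matrix.trace A := by
  simp [frob, Matrix.trace, Matrix.one_apply]

lemma frob_one_right (A : Matrix (Fin 3) (Fin 3) ℝ) : frob A 1 = Matrix.trace A := by
  simp [frob, Matrix.trace, Matrix.one_apply]

lemma frob_self_nonneg (A : Matrix (Fin 3) (Fin 3) ℝ) : 0 ≤ frob A A :=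
  Finset.sum_nonneg fun _ _ => Finset.sum_nonneg fun _ _ => mul_self_nonneg _

lemma fnorm_mul_self (A : Matrix (Fin 3) (Fin 3) ℝ) : fnorm A * fnorm A = frob A A :=
  Real.mul_self_sqrt (frob_self_nonneg A)

/-- The Cauchy–Schwarz inequality for the Frobenius inner product. -/
lemma frob_le_fnorm_mul_fnorm (A B : Matrix (Fin 3) (Fin 3) ℝ) :
    frob A B ≤ fnorm A * fnorm B := by
  have h := Real.sum_mul_le_sqrt_mul_sqrt Finset.univ
    (fun p : Fin 3 × Fin 3 => A p.1 p.2) (fun p => B p.1 p.2)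
  simpa only [fnorm, frob, Fintype.sum_prod_type, sq] using h

lemma trace_devM (A : Matrix (Fin 3) (Fin 3) ℝ) : Matrix.trace (devM A) = 0 := by
  simp [devM]

lemma frob_devM_right {A : Matrix (Fin 3) (Fin 3) ℝ} (hA : Matrix.trace A = 0)
    (B : Matrix (Fin 3) (Fin 3) ℝ) : frob A (devM B) = frob A B := by
  simp [devM, frob_sub_right, frob_smul_right, frob_one_right, hA]

/-- A unit deviatoric direction gives a supporting functional of the yield function. -/
lemma frob_add_trace_sub_le_PsiDP (η c : ℝ) {n : Matrix (Fin 3) (Fin 3) ℝ}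
    (hn : Matrix.trace n = 0) (hnorm : fnorm n = 1) (τ : Matrix (Fin 3) (Fin 3) ℝ) :
    (Real.sqrt 2)⁻¹ * frob n τ + η / 3 * Matrix.trace τ - c ≤ PsiDP η c τ := by
  have h := frob_le_fnorm_mul_fnorm n (devM τ)
  rw [frob_devM_right hn, hnorm, one_mul] at h
  rw [PsiDP, one_div, Real.sqrt_inv]
  gcongr

/-- Maximum plastic dissipation for the Drucker–Prager smooth return: in the smooth-return
case the plastic strain increment satisfies `(εₖᵖ − εₖ₋₁ᵖ) : (τ − σₖ) ≤ 0` for every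
admissible `τ` with `Ψ(τ) ≤ 0`. -/
theorem druckerPrager_smooth_return_max_dissipation (K G η c : ℝ)
    (hK : 0 < K) (hG : 0 < G) (hη : 0 < η) (hc : 0 < c)
    (εk εp : Matrix (Fin 3) (Fin 3) ℝ) (hεk : εk.IsSymm) (hεp : εp.IsSymm)
    (σtr str ntr σk εpk : Matrix (Fin 3) (Fin 3) ℝ) (ρtr ptr Δlam : ℝ)
    (hσtr : σtr = Celast K G (εk - εp))
    (hstr : str = devM σtr) (hρtr : ρtr = fnorm str)
    (hptr : ptr = Matrix.trace σtr / 3)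
    (hcase1 : 0 < PsiDP η c σtr)
    (hcase2 : η * ptr - K * η ^ 2 / (G * Real.sqrt 2) * ρtr < c)
    (hntr : ntr = ρtr⁻¹ • str)
    (hΔlam : Δlam = PsiDP η c σtr / (G + K * η ^ 2))
    (hσk : σk = σtr - (Δlam * (G * Real.sqrt 2)) • ntr -
      (Δlam * (K * η)) • (1 : Matrix (Fin 3) (Fin 3) ℝ))
    (hεpk : εpk = εp + (Δlam * (Real.sqrt 2)⁻¹) • ntr +
      (Δlam * (η / 3)) • (1 : Matrix (Fin 3) (Fin 3) ℝ)) :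
    ∀ τ : Matrix (Fin 3) (Fin 3) ℝ, τ.IsSymm → PsiDP η c τ ≤ 0 →
      frob (εpk - εp) (τ - σk) ≤ 0 := by
  subst hσtr hstr hρtr hptr
  set σ := Celast K G (εk - εp)
  set ρ := fnorm (devM σ) with hρ
  have hΨ : PsiDP η c σ = (Real.sqrt 2)⁻¹ * ρ + η / 3 * Matrix.trace σ - c := by
    rw [PsiDP, one_div, Real.sqrt_inv]
  have hρ0 : ρ ≠ 0 := by
    intro h
    rw [hΨ, h] at hcase1
    rw [h] at hcase2
    linarith
  have hden : 0 < G + K * η ^ 2 := by positivity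
  have hΔ : 0 ≤ Δlam := hΔlam ▸ (div_pos hcase1 hden).le
  have hntrace : Matrix.trace ntr = 0 := by rw [hntr, Matrix.trace_smul, trace_devM, smul_zero]
  have hself : frob ntr ntr = 1 := by
    rw [hntr, frob_smul_left, frob_smul_right, ← fnorm_mul_self, ← hρ]
    field_simp
  have hnorm : fnorm ntr = 1 := by rw [fnorm, hself, Real.sqrt_one]
  have hnσ : frob ntr σ = ρ := by
    rw [← frob_devM_right hntrace, hntr, frob_smul_left, ← fnorm_mul_self, ← hρ]
    field_simp
  have hnσk : frob ntr σk = ρ - Δlam * (G * Real.sqrt 2) := by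
    rw [hσk, frob_sub_right, frob_sub_right, frob_smul_right, frob_smul_right, hself,
      frob_one_right, hntrace, hnσ]
    ring
  have htrσk : Matrix.trace σk = Matrix.trace σ - 3 * (Δlam * (K * η)) := by
    simp [hσk, hntrace]
    ring
  have hyield : (Real.sqrt 2)⁻¹ * frob ntr σk + η / 3 * Matrix.trace σk - c = 0 := by
    have h := (eq_div_iff hden.ne').mp hΔlam
    have h2 : (Real.sqrt 2)⁻¹ * (Δlam * (G * Real.sqrt 2)) = Δlam * G := by field_simp
    rw [hΨ] at h
    rw [hnσk, htrσk, mul_sub, h2]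
    linarith
  intro τ _ hτ
  have hle := (frob_add_trace_sub_le_PsiDP η c hntrace hnorm τ).trans hτ
  have hinc : frob (εpk - εp) (τ - σk) =
      Δlam * (((Real.sqrt 2)⁻¹ * frob ntr τ + η / 3 * Matrix.trace τ - c) -
        ((Real.sqrt 2)⁻¹ * frob ntr σk + η / 3 * Matrix.trace σk - c)) := by
    rw [hεpk, add_assoc, add_sub_cancel_left, frob_add_left, frob_smul_left, frob_smul_left,
      frob_one_left, frob_sub_right, Matrix.trace_sub]
    ring
  rw [hinc, hyield, sub_zero]
  exact mul_nonpos_of_nonneg_of_nonpos hΔ hle
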